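/- arXiv:1509.08841 — 2 statements merged into one kernel-verified Lean document; each statement's English description precedes it below -/
import Mathlib

section
/- Let A_1(N), …, A_k(N) be a unitarily invariant ensemble with limit law τ. Fix N₀ and indices i_1, …, i_r, j_1, …, j_r ∈ {1, …, N₀}. Then for all noncommutative polynomials q_1, …, q_r in k variables, lim_{N→∞} E Tr( E_{i_r j_1} q_1(A_1(N),…,A_k(N)) E_{i_1 j_2} q_2(A_1(N),…,A_k(N)) E_{i_2 j_3} ⋯ E_{i_{r−1} j_r} q_r(A_1(N),…,A_k(N)) ) = ∏_{s=1}^r δ_{j_s = i_s} τ(q_s), where Tr is the non-normalized trace. -/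
open Matrix MeasureTheory Filter

noncomputable instance {N : ℕ} : MeasurableSpace (Matrix.unitaryGroup (Fin N) ℂ) :=
  borel _

/-- The ℓ²→ℓ² operator norm of a complex matrix. -/
noncomputable def opNorm {N : ℕ} (X : Matrix (Fin N) (Fin N) ℂ) : ℝ :=
  ‖Matrix.toEuclideanCLM (𝕜 := ℂ) X‖

/-- Evaluation of a noncommutative polynomial `q` at the matrices `UΛ₁U*, …, UΛ_kU*`. -/
noncomputable def evalAt {k N : ℕ} (Λ : Fin k → Matrix (Fin N) (Fin N) ℂ)
    (U : Matrix.unitaryGroup (Fin N) ℂ) (q : FreeAlgebra ℂ (Fin k)) :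
    Matrix (Fin N) (Fin N) ℂ :=
  FreeAlgebra.lift ℂ
    (fun j => (U : Matrix (Fin N) (Fin N) ℂ) * Λ j * (U : Matrix (Fin N) (Fin N) ℂ)ᴴ) q

/-- The matrix unit `E_{ij}` (for `i, j ∈ {1,…,N₀}`) padded by zeros to an `N×N` matrix. -/
def padE (N₀ N : ℕ) (i j : Fin N₀) : Matrix (Fin N) (Fin N) ℂ :=
  Matrix.of fun a b => if ((a : ℕ) = (i : ℕ) ∧ (b : ℕ) = (j : ℕ)) then 1 else 0


/-! ### Operator norm facts -/

section OpNormFacts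
open scoped Matrix.Norms.L2Operator

lemma opNorm_eq {N : ℕ} (X : Matrix (Fin N) (Fin N) ℂ) : opNorm X = ‖X‖ := rfl

lemma opNorm_conj {N : ℕ} (U : Matrix.unitaryGroup (Fin N) ℂ) (X : Matrix (Fin N) (Fin N) ℂ) :
    opNorm ((U : Matrix (Fin N) (Fin N) ℂ) * X * (U : Matrix (Fin N) (Fin N) ℂ)ᴴ) = opNorm X := by
  rw [opNorm_eq, opNorm_eq]
  have h := CStarRing.norm_mul_coe_unitary ((U : Matrix (Fin N) (Fin N) ℂ) * X) (star U)
  have h2 := CStarRing.norm_coe_unitary_mul U X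
  rw [← h2, ← h]
  rfl

lemma opNorm_row {N : ℕ} (X : Matrix (Fin N) (Fin N) ℂ) (a : Fin N) :
    ∑ b, ‖X a b‖ ^ 2 ≤ opNorm X ^ 2 := by
  have h := (Xᴴ).l2_opNorm_mulVec (WithLp.toLp 2 (Pi.single a (1 : ℂ)))
  rw [Matrix.l2_opNorm_conjTranspose] at h
  have h1 : ‖(WithLp.toLp 2 (Pi.single a (1 : ℂ)) : EuclideanSpace ℂ (Fin N))‖ = 1 := by
    simp
  rw [h1, mul_one] at h
  have h2 := pow_le_pow_left₀ (norm_nonneg _) h 2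
  rw [EuclideanSpace.norm_sq_eq] at h2
  rw [opNorm_eq]
  refine le_trans (le_of_eq ?_) h2
  refine Finset.sum_congr rfl fun b _ => ?_
  simp

lemma opNorm_nonneg' {N : ℕ} (X : Matrix (Fin N) (Fin N) ℂ) : 0 ≤ opNorm X := norm_nonneg _

lemma opNorm_entry {N : ℕ} (X : Matrix (Fin N) (Fin N) ℂ) (a b : Fin N) :
    ‖X a b‖ ≤ opNorm X := by
  refine (sq_le_sq₀ (norm_nonneg _) (opNorm_nonneg' X)).mp ?_
  exact (Finset.single_le_sum (f := fun b => ‖X a b‖ ^ 2) (fun _ _ => by positivity)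
    (Finset.mem_univ b)).trans (opNorm_row X a)

lemma opNorm_one_le {N : ℕ} : opNorm (1 : Matrix (Fin N) (Fin N) ℂ) ≤ 1 := by
  unfold opNorm
  rw [map_one]
  exact ContinuousLinearMap.norm_id_le

lemma opNorm_smul_one_le {N : ℕ} (c : ℂ) :
    opNorm (c • (1 : Matrix (Fin N) (Fin N) ℂ)) ≤ ‖c‖ := by
  rw [opNorm_eq]
  refine (norm_smul_le _ _).trans ?_
  have := opNorm_one_le (N := N)
  rw [opNorm_eq] at this
  nlinarith [norm_nonneg c]

lemma opNorm_sub_le {N : ℕ} (X Y : Matrix (Fin N) (Fin N) ℂ) :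
    opNorm (X - Y) ≤ opNorm X + opNorm Y := norm_sub_le X Y

lemma exists_bound_lift {k : ℕ} (C : ℝ) (q : FreeAlgebra ℂ (Fin k)) :
    ∃ K : ℝ, 0 ≤ K ∧ ∀ (N : ℕ) (B : Fin k → Matrix (Fin N) (Fin N) ℂ), (∀ j, opNorm (B j) ≤ C) →
      opNorm (FreeAlgebra.lift ℂ B q) ≤ K := by
  induction q with
  | grade0 r =>
    refine ⟨‖r‖, norm_nonneg _, fun N B _ => ?_⟩
    rw [AlgHom.commutes, Algebra.algebraMap_eq_smul_one]
    exact opNorm_smul_one_le r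
  | grade1 x =>
    refine ⟨|C|, abs_nonneg _, fun N B h => ?_⟩
    rw [FreeAlgebra.lift_ι_apply]
    exact (h x).trans (le_abs_self C)
  | mul a b ha hb =>
    obtain ⟨K, hK, h⟩ := ha
    obtain ⟨L, hL, h'⟩ := hb
    refine ⟨K * L, mul_nonneg hK hL, fun N B hB => ?_⟩
    rw [map_mul]
    exact (norm_mul_le (FreeAlgebra.lift ℂ B a) (FreeAlgebra.lift ℂ B b)).trans
      (mul_le_mul (h N B hB) (h' N B hB) (norm_nonneg _) hK)
  | add a b ha hb =>
    obtain ⟨K, hK, h⟩ := ha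
    obtain ⟨L, hL, h'⟩ := hb
    refine ⟨K + L, add_nonneg hK hL, fun N B hB => ?_⟩
    rw [map_add]
    exact (norm_add_le (FreeAlgebra.lift ℂ B a) (FreeAlgebra.lift ℂ B b)).trans (add_le_add (h N B hB) (h' N B hB))

end OpNormFacts

lemma unitary_mul_conj {N : ℕ} (U : Matrix.unitaryGroup (Fin N) ℂ) :
    (U : Matrix (Fin N) (Fin N) ℂ) * (U : Matrix (Fin N) (Fin N) ℂ)ᴴ = 1 :=
  Unitary.coe_mul_star_self U

lemma unitary_conj_mul {N : ℕ} (U : Matrix.unitaryGroup (Fin N) ℂ) :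
    (U : Matrix (Fin N) (Fin N) ℂ)ᴴ * (U : Matrix (Fin N) (Fin N) ℂ) = 1 :=
  Unitary.coe_star_mul_self U

/-- Conjugation of `X` by `U`. -/
noncomputable def cj {N : ℕ} (X : Matrix (Fin N) (Fin N) ℂ) (U : Matrix.unitaryGroup (Fin N) ℂ) :
    Matrix (Fin N) (Fin N) ℂ :=
  (U : Matrix (Fin N) (Fin N) ℂ) * X * (U : Matrix (Fin N) (Fin N) ℂ)ᴴ

lemma evalAt_eq {k N : ℕ} (Λ : Fin k → Matrix (Fin N) (Fin N) ℂ)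
    (U : Matrix.unitaryGroup (Fin N) ℂ) (q : FreeAlgebra ℂ (Fin k)) :
    evalAt Λ U q = cj (FreeAlgebra.lift ℂ Λ q) U := by
  unfold evalAt cj
  induction q with
  | grade0 r =>
    rw [AlgHom.commutes, AlgHom.commutes]
    simp only [Algebra.algebraMap_eq_smul_one]
    rw [Matrix.mul_smul, Matrix.smul_mul, mul_one, unitary_mul_conj]
  | grade1 x => simp only [FreeAlgebra.lift_ι_apply]
  | mul a b ha hb =>
    rw [map_mul, map_mul, ha, hb]
    simp only [Matrix.mul_assoc]
    rw [← Matrix.mul_assoc (U : Matrix (Fin N) (Fin N) ℂ)ᴴ (U : Matrix (Fin N) (Fin N) ℂ),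
      unitary_conj_mul, Matrix.one_mul]
  | add a b ha hb =>
    rw [map_add, map_add, ha, hb, Matrix.mul_add, Matrix.add_mul]

lemma cj_trace {N : ℕ} (X : Matrix (Fin N) (Fin N) ℂ) (U : Matrix.unitaryGroup (Fin N) ℂ) :
    (cj X U).trace = X.trace := by
  unfold cj
  rw [Matrix.trace_mul_cycle, unitary_conj_mul, Matrix.one_mul]

lemma cj_mul {N : ℕ} (X : Matrix (Fin N) (Fin N) ℂ) (V U : Matrix.unitaryGroup (Fin N) ℂ) :
    cj X (V * U) = (V : Matrix (Fin N) (Fin N) ℂ) * cj X U * (V : Matrix (Fin N) (Fin N) ℂ)ᴴ := by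
  unfold cj
  simp [Matrix.mul_assoc, Matrix.conjTranspose_mul]

lemma cj_continuous {N : ℕ} (X : Matrix (Fin N) (Fin N) ℂ) : Continuous (cj X) := by
  unfold cj
  fun_prop

lemma cj_sub_smul_one {N : ℕ} (X : Matrix (Fin N) (Fin N) ℂ) (c : ℂ)
    (U : Matrix.unitaryGroup (Fin N) ℂ) : cj (X - c • 1) U = cj X U - c • 1 := by
  unfold cj
  rw [Matrix.mul_sub, Matrix.sub_mul, Matrix.mul_smul, Matrix.smul_mul, mul_one, unitary_mul_conj]

lemma cj_entry_le {N : ℕ} (X : Matrix (Fin N) (Fin N) ℂ) (U : Matrix.unitaryGroup (Fin N) ℂ)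
    (a b : Fin N) : ‖cj X U a b‖ ≤ opNorm X := by
  have := opNorm_entry (cj X U) a b
  unfold cj at this ⊢
  rwa [opNorm_conj] at this

lemma cj_row_le {N : ℕ} (X : Matrix (Fin N) (Fin N) ℂ) (U : Matrix.unitaryGroup (Fin N) ℂ)
    (a : Fin N) : ∑ b, ‖cj X U a b‖ ≤ √N * opNorm X := by
  have h := opNorm_row (cj X U) a
  have h1 : opNorm (cj X U) = opNorm X := opNorm_conj U X
  rw [h1] at h
  have h2 := sq_sum_le_card_mul_sum_sq (s := Finset.univ) (f := fun b => ‖cj X U a b‖)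
  refine (sq_le_sq₀ (Finset.sum_nonneg fun _ _ => norm_nonneg _) (mul_nonneg (Real.sqrt_nonneg _) (opNorm_nonneg' X))).mp ?_
  rw [mul_pow, Real.sq_sqrt (Nat.cast_nonneg _)]
  refine h2.trans ?_
  rw [Finset.card_univ, Fintype.card_fin]
  gcongr

/-! ### Two families of unitaries -/

lemma swap_sq {N : ℕ} (a b : Fin N) :
    (Equiv.swap a b).permMatrix ℂ * (Equiv.swap a b).permMatrix ℂ = 1 := by
  rw [← Matrix.permMatrix_mul, Equiv.swap_mul_self, Matrix.permMatrix_one]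

lemma swap_conj {N : ℕ} (a b : Fin N) :
    ((Equiv.swap a b).permMatrix ℂ)ᴴ = (Equiv.swap a b).permMatrix ℂ := by
  rw [Matrix.conjTranspose_permMatrix, Equiv.swap_inv]

/-- The swap matrix as a unitary. -/
noncomputable def swapU {N : ℕ} (a b : Fin N) : Matrix.unitaryGroup (Fin N) ℂ :=
  ⟨(Equiv.swap a b).permMatrix ℂ, by
    rw [Matrix.mem_unitaryGroup_iff, Matrix.star_eq_conjTranspose, swap_conj, swap_sq]⟩

/-- A square root of the swap matrix. -/
noncomputable def rootU {N : ℕ} (a b : Fin N) : Matrix.unitaryGroup (Fin N) ℂ :=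
  ⟨((1 + Complex.I) / 2) • (1 : Matrix (Fin N) (Fin N) ℂ) +
      ((1 - Complex.I) / 2) • (Equiv.swap a b).permMatrix ℂ, by
    rw [Matrix.mem_unitaryGroup_iff, Matrix.star_eq_conjTranspose, Matrix.conjTranspose_add,
      Matrix.conjTranspose_smul, Matrix.conjTranspose_smul, swap_conj, Matrix.conjTranspose_one]
    simp only [Matrix.add_mul, Matrix.mul_add, Matrix.smul_mul, Matrix.mul_smul, swap_sq,
      Matrix.one_mul, Matrix.mul_one, smul_smul]
    ext i j
    simp [-PEquiv.toMatrix_apply]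
    ring_nf
    simp only [Complex.I_sq]
    ring⟩

lemma cj_swap {N : ℕ} (X : Matrix (Fin N) (Fin N) ℂ) (U : Matrix.unitaryGroup (Fin N) ℂ)
    (c d a b : Fin N) : cj X (swapU c d * U) a b = cj X U (Equiv.swap c d a) (Equiv.swap c d b) := by
  rw [cj_mul]
  simp only [swapU]
  rw [swap_conj, PEquiv.toMatrix_toPEquiv_mul, PEquiv.mul_toMatrix_toPEquiv]
  simp

lemma cj_root {N : ℕ} (X : Matrix (Fin N) (Fin N) ℂ) (U : Matrix.unitaryGroup (Fin N) ℂ)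
    (a b : Fin N) : cj X (rootU a b * U) a b =
      (cj X U a b + cj X U b a + Complex.I * (cj X U a a - cj X U b b)) / 2 := by
  rw [cj_mul]
  simp only [rootU]
  rw [Matrix.conjTranspose_add,
      Matrix.conjTranspose_smul, Matrix.conjTranspose_smul, swap_conj, Matrix.conjTranspose_one]
  simp only [Matrix.add_mul, Matrix.mul_add, Matrix.smul_mul, Matrix.mul_smul,
      Matrix.one_mul, Matrix.mul_one, smul_smul, PEquiv.toMatrix_toPEquiv_mul,
      PEquiv.mul_toMatrix_toPEquiv]
  simp
  ring_nf
  simp only [Complex.I_sq]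
  ring

/-! ### Integral estimates -/

instance {N : ℕ} : BorelSpace (Matrix.unitaryGroup (Fin N) ℂ) := ⟨rfl⟩

lemma integrable_of_cont {N : ℕ} (μ : Measure (Matrix.unitaryGroup (Fin N) ℂ))
    [IsProbabilityMeasure μ] {E : Type*} [NormedAddCommGroup E] [SecondCountableTopology E]
    (f : Matrix.unitaryGroup (Fin N) ℂ → E) (hf : Continuous f)
    (C : ℝ) (hC : ∀ U, ‖f U‖ ≤ C) : Integrable f μ :=
  by
    borelize E
    exact Integrable.of_bound hf.measurable.aestronglyMeasurable C
      (Eventually.of_forall hC)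

lemma cj_entry_cont {N : ℕ} (X : Matrix (Fin N) (Fin N) ℂ) (a b : Fin N) :
    Continuous (fun U => cj X U a b) := (cj_continuous X).matrix_elem a b

lemma cj_norm_integrable {N : ℕ} (μ : Measure (Matrix.unitaryGroup (Fin N) ℂ))
    [IsProbabilityMeasure μ] (X : Matrix (Fin N) (Fin N) ℂ) (a b : Fin N) :
    Integrable (fun U => ‖cj X U a b‖) μ :=
  integrable_of_cont μ _ (cj_entry_cont X a b).norm (opNorm X) (fun U => by
    rw [norm_norm]; exact cj_entry_le X U a b)

lemma offdiag {N : ℕ} (μ : Measure (Matrix.unitaryGroup (Fin N) ℂ))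
    [IsProbabilityMeasure μ] [μ.IsMulLeftInvariant] (X : Matrix (Fin N) (Fin N) ℂ)
    (hN : 2 ≤ N) (a b : Fin N) (hab : a ≠ b) :
    ∫ U, ‖cj X U a b‖ ∂μ ≤ √N * opNorm X / (N - 1) := by
  have key : ∀ c, a ≠ c → ∫ U, ‖cj X U a c‖ ∂μ = ∫ U, ‖cj X U a b‖ ∂μ := by
    intro c hc
    rw [← integral_mul_left_eq_self (μ := μ) (fun U => ‖cj X U a c‖) (swapU b c)]
    simp only [cj_swap]
    rw [Equiv.swap_apply_of_ne_of_ne hab hc, Equiv.swap_apply_right]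
  have h1 : ∑ c ∈ Finset.univ.erase a, ∫ U, ‖cj X U a c‖ ∂μ
      = (N - 1) * ∫ U, ‖cj X U a b‖ ∂μ := by
    rw [Finset.sum_congr rfl (fun c hc => key c (Finset.ne_of_mem_erase hc).symm)]
    rw [Finset.sum_const, Finset.card_erase_of_mem (Finset.mem_univ _), Finset.card_univ,
      Fintype.card_fin, nsmul_eq_mul, Nat.cast_sub (by omega), Nat.cast_one]
  have h2 : ∑ c ∈ Finset.univ.erase a, ∫ U, ‖cj X U a c‖ ∂μ ≤ √N * opNorm X := by
    rw [← integral_finset_sum _ (fun c _ => cj_norm_integrable μ X a c)]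
    calc _ ≤ ∫ U, √N * opNorm X ∂μ := by
          refine integral_mono (integrable_finset_sum _ (fun c _ => cj_norm_integrable μ X a c))
            (integrable_const _) fun U => ?_
          refine (Finset.sum_le_sum_of_subset_of_nonneg (Finset.erase_subset _ _)
            (fun _ _ _ => norm_nonneg _)).trans (cj_row_le X U a)
      _ = _ := by simp
  have hN' : (2 : ℝ) ≤ N := by exact_mod_cast hN
  rw [le_div_iff₀ (by linarith)]
  linarith

lemma diag_diff {N : ℕ} (μ : Measure (Matrix.unitaryGroup (Fin N) ℂ))
    [IsProbabilityMeasure μ] [μ.IsMulLeftInvariant] (X : Matrix (Fin N) (Fin N) ℂ)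
    (hN : 2 ≤ N) (a b : Fin N) :
    ∫ U, ‖cj X U a a - cj X U b b‖ ∂μ ≤ 4 * (√N * opNorm X / (N - 1)) := by
  have hN' : (2 : ℝ) ≤ N := by exact_mod_cast hN
  have hpos : 0 ≤ √N * opNorm X / (N - 1) :=
    div_nonneg (mul_nonneg (Real.sqrt_nonneg _) (opNorm_nonneg' X)) (by linarith)
  by_cases hab : a = b
  · subst hab
    simpa using hpos
  have hroot : ∫ U, ‖cj X (rootU a b * U) a b‖ ∂μ = ∫ U, ‖cj X U a b‖ ∂μ :=
    integral_mul_left_eq_self (μ := μ) (fun U => ‖cj X U a b‖) (rootU a b)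
  have hri : Integrable (fun U => ‖cj X (rootU a b * U) a b‖) μ :=
    (cj_norm_integrable μ X a b).comp_mul_left (rootU a b)
  have hpt : ∀ U, ‖cj X U a a - cj X U b b‖ ≤
      2 * ‖cj X (rootU a b * U) a b‖ + ‖cj X U a b‖ + ‖cj X U b a‖ := by
    intro U
    have e : Complex.I * (cj X U a a - cj X U b b) =
        2 * cj X (rootU a b * U) a b - cj X U a b - cj X U b a := by
      rw [cj_root]; ring
    have e2 := congrArg norm e
    rw [norm_mul, Complex.norm_I, one_mul] at e2
    rw [e2]
    refine (norm_sub_le _ _).trans ?_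
    gcongr
    refine (norm_sub_le _ _).trans ?_
    gcongr
    simp
  have hi1 := (hri.const_mul 2)
  have hi2 := cj_norm_integrable μ X a b
  have hi3 := cj_norm_integrable μ X b a
  have hle : ∫ U, ‖cj X U a a - cj X U b b‖ ∂μ ≤
      ∫ U, (2 * ‖cj X (rootU a b * U) a b‖ + ‖cj X U a b‖ + ‖cj X U b a‖) ∂μ := by
    refine integral_mono_of_nonneg (Eventually.of_forall fun U => norm_nonneg _)
      ((hi1.add hi2).add hi3) (Eventually.of_forall hpt)
  have hsum : ∫ U, (2 * ‖cj X (rootU a b * U) a b‖ + ‖cj X U a b‖ + ‖cj X U b a‖) ∂μ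
      = 2 * ∫ U, ‖cj X U a b‖ ∂μ + ∫ U, ‖cj X U a b‖ ∂μ + ∫ U, ‖cj X U b a‖ ∂μ := by
    have e1 := integral_add (hi1.add hi2) hi3
    have e2 := integral_add hi1 hi2
    simp only [Pi.add_apply] at e1
    rw [e1, e2, integral_const_mul, hroot]
  rw [hsum] at hle
  have o1 := offdiag μ X hN a b hab
  have o2 := offdiag μ X hN b a (Ne.symm hab)
  linarith

lemma diag_bound {N : ℕ} (μ : Measure (Matrix.unitaryGroup (Fin N) ℂ))
    [IsProbabilityMeasure μ] [μ.IsMulLeftInvariant] (X : Matrix (Fin N) (Fin N) ℂ)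
    (hN : 2 ≤ N) (a : Fin N) :
    ∫ U, ‖cj X U a a - X.trace / N‖ ∂μ ≤ 4 * (√N * opNorm X / (N - 1)) := by
  have hN0 : (N : ℂ) ≠ 0 := by exact_mod_cast (by omega : N ≠ 0)
  have hNr : (0 : ℝ) < N := by exact_mod_cast (by omega : 0 < N)
  have hpt : ∀ U, ‖cj X U a a - X.trace / N‖ ≤
      (N : ℝ)⁻¹ * ∑ b, ‖cj X U a a - cj X U b b‖ := by
    intro U
    have e : cj X U a a - X.trace / N = (N : ℂ)⁻¹ * ∑ b, (cj X U a a - cj X U b b) := by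
      rw [← cj_trace X U, Matrix.trace, Finset.sum_sub_distrib]
      simp
      field_simp
    rw [e, norm_mul, norm_inv, Complex.norm_natCast]
    gcongr
    exact norm_sum_le _ _
  have hi : ∀ b, Integrable (fun U => ‖cj X U a a - cj X U b b‖) μ := fun b =>
    integrable_of_cont μ _ ((cj_entry_cont X a a).sub (cj_entry_cont X b b)).norm
      (opNorm X + opNorm X) (fun U => by
        rw [norm_norm]
        exact (norm_sub_le _ _).trans (add_le_add (cj_entry_le X U a a) (cj_entry_le X U b b)))
  have hle : ∫ U, ‖cj X U a a - X.trace / N‖ ∂μ ≤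
      ∫ U, (N : ℝ)⁻¹ * ∑ b, ‖cj X U a a - cj X U b b‖ ∂μ :=
    integral_mono_of_nonneg (Eventually.of_forall fun U => norm_nonneg _)
      ((integrable_finset_sum _ fun b _ => hi b).const_mul _) (Eventually.of_forall hpt)
  refine hle.trans ?_
  rw [integral_const_mul, integral_finset_sum _ fun b _ => hi b]
  have := Finset.sum_le_sum (fun b (_ : b ∈ Finset.univ) => diag_diff μ X hN a b)
  rw [Finset.sum_const, Finset.card_univ, Fintype.card_fin, nsmul_eq_mul] at this
  rw [inv_mul_le_iff₀ hNr]
  exact this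

lemma entry_bound {N : ℕ} (μ : Measure (Matrix.unitaryGroup (Fin N) ℂ))
    [IsProbabilityMeasure μ] [μ.IsMulLeftInvariant] (X : Matrix (Fin N) (Fin N) ℂ)
    (hN : 2 ≤ N) (a b : Fin N) :
    ∫ U, ‖cj X U a b - (if a = b then 1 else 0) * (X.trace / N)‖ ∂μ
      ≤ 4 * (√N * opNorm X / (N - 1)) := by
  by_cases hab : a = b
  · subst hab
    simpa using diag_bound μ X hN a
  · have h := offdiag μ X hN a b hab
    have hN' : (2 : ℝ) ≤ N := by exact_mod_cast hN
    have hpos : 0 ≤ √N * opNorm X / (N - 1) :=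
      div_nonneg (mul_nonneg (Real.sqrt_nonneg _) (opNorm_nonneg' X)) (by linarith)
    simp only [hab, if_false, zero_mul, sub_zero]
    linarith

/-! ### Products and the trace formula -/

lemma norm_prod_sub_le {ι : Type*} (T : Finset ι) (x y : ι → ℂ) (K : ℝ) (hK : 1 ≤ K)
    (hx : ∀ s, ‖x s‖ ≤ K) (hy : ∀ s, ‖y s‖ ≤ K) :
    ‖∏ s ∈ T, x s - ∏ s ∈ T, y s‖ ≤ K ^ T.card * ∑ s ∈ T, ‖x s - y s‖ := by
  classical
  induction T using Finset.induction_on with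
  | empty => simp
  | insert a T ha ih =>
    rw [Finset.prod_insert ha, Finset.prod_insert ha, Finset.sum_insert ha,
      Finset.card_insert_of_notMem ha]
    have e : x a * ∏ s ∈ T, x s - y a * ∏ s ∈ T, y s =
      (x a - y a) * ∏ s ∈ T, x s + y a * (∏ s ∈ T, x s - ∏ s ∈ T, y s) := by ring
    rw [e]
    have hP : ‖∏ s ∈ T, x s‖ ≤ K ^ T.card := by
      rw [norm_prod]
      exact (Finset.prod_le_prod (fun s _ => norm_nonneg _) (fun s _ => hx s)).trans (by simp)
    have hP' : K ^ T.card ≤ K ^ (T.card + 1) := pow_le_pow_right₀ hK (Nat.le_succ _)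
    calc _ ≤ ‖x a - y a‖ * ‖∏ s ∈ T, x s‖ + ‖y a‖ * ‖∏ s ∈ T, x s - ∏ s ∈ T, y s‖ := by
          refine (norm_add_le _ _).trans ?_
          rw [norm_mul, norm_mul]
      _ ≤ ‖x a - y a‖ * K ^ (T.card + 1) + K * (K ^ T.card * ∑ s ∈ T, ‖x s - y s‖) := by
          gcongr
          · exact hP.trans hP'
          · exact hy a
      _ = _ := by ring

lemma list_prod_single {N : ℕ} (n : ℕ) (a b : Fin (n + 1) → Fin N)
    (Q : Fin (n + 1) → Matrix (Fin N) (Fin N) ℂ) :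
    (List.ofFn (fun s => Matrix.single (a s) (b s) (1 : ℂ) * Q s)).prod =
      (∏ s : Fin n, Q s.castSucc (b s.castSucc) (a s.succ)) •
        (Matrix.single (a 0) (b (Fin.last n)) (1 : ℂ) * Q (Fin.last n)) := by
  induction n with
  | zero => simp
  | succ n ih =>
    rw [List.ofFn_succ, List.prod_cons, ih (fun s => a s.succ) (fun s => b s.succ)
      (fun s => Q s.succ), Matrix.mul_smul, ← Matrix.mul_assoc, Matrix.single_mul_mul_single,
      Fin.prod_univ_succ, mul_comm, ← smul_smul, ← Matrix.smul_mul]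
    rw [smul_comm]
    simp only [← Matrix.smul_mul, Matrix.smul_single]
    simp

lemma trace_formula {N : ℕ} (m : ℕ) (i j : Fin (m + 1) → Fin N)
    (Q : Fin (m + 1) → Matrix (Fin N) (Fin N) ℂ) :
    Matrix.trace (List.ofFn (fun s => Matrix.single (i (s - 1)) (j s) (1 : ℂ) * Q s)).prod =
      ∏ s, Q s (j s) (i s) := by
  rw [list_prod_single m (fun s => i (s - 1)) j Q, Matrix.trace_smul, Matrix.trace_single_mul,
    Fin.prod_univ_castSucc]
  have h0 : (0 : Fin (m + 1)) - 1 = Fin.last m := by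
    rw [sub_eq_iff_eq_add]; simp
  have h1 : ∀ s : Fin m, s.succ - 1 = s.castSucc := by
    intro s
    rw [sub_eq_iff_eq_add]; simp
  simp [h0, h1]

lemma padE_eq {N₀ N : ℕ} (h : N₀ ≤ N) (i j : Fin N₀) :
    padE N₀ N i j = Matrix.single (Fin.castLE h i) (Fin.castLE h j) 1 := by
  ext a b
  simp only [padE, Matrix.of_apply, Matrix.single_apply, Fin.ext_iff, Fin.val_castLE]
  simp only [eq_comm]

lemma tendsto_rate (K : ℝ) : Tendsto (fun N : ℕ => √N * K / ((N : ℝ) - 1)) atTop (nhds 0) := by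
  have h1 : Tendsto (fun N : ℕ => 2 * |K| / √N) atTop (nhds 0) :=
    tendsto_const_nhds.div_atTop (Real.tendsto_sqrt_atTop.comp tendsto_natCast_atTop_atTop)
  refine squeeze_zero_norm' ?_ h1
  filter_upwards [eventually_ge_atTop 2] with N hN
  have hN' : (2 : ℝ) ≤ N := by exact_mod_cast hN
  have hs : 0 < √(N : ℝ) := Real.sqrt_pos.mpr (by linarith)
  rw [norm_div, norm_mul, Real.norm_eq_abs, Real.norm_eq_abs, Real.norm_eq_abs, abs_of_pos hs,
    abs_of_pos (by linarith : (0 : ℝ) < N - 1), div_le_div_iff₀ (by linarith) hs]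
  have : √(N : ℝ) * √(N : ℝ) = N := Real.mul_self_sqrt (by linarith)
  calc √(N : ℝ) * |K| * √(N : ℝ) = |K| * (√(N : ℝ) * √(N : ℝ)) := by ring
    _ = |K| * N := by rw [this]
    _ ≤ 2 * |K| * (N - 1) := by nlinarith [abs_nonneg K]

/-- Lemma 3.1: for a unitarily invariant ensemble with limit law `τ`,
`lim_N E Tr(E_{i_r j_1} q_1(A) E_{i_1 j_2} q_2(A) ⋯ E_{i_{r-1} j_r} q_r(A))
  = ∏_s δ_{j_s = i_s} τ(q_s)`. -/
theorem unitarilyInvariant_matrixUnits_trace_limit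
    (k N₀ : ℕ)
    (Λ : (N : ℕ) → Fin k → Matrix (Fin N) (Fin N) ℂ)
    (hΛsa : ∀ N j, (Λ N j)ᴴ = Λ N j)
    (hΛbdd : ∃ C : ℝ, ∀ N j, opNorm (Λ N j) ≤ C)
    (μ : (N : ℕ) → Measure (Matrix.unitaryGroup (Fin N) ℂ))
    (hprob : ∀ N, IsProbabilityMeasure (μ N))
    (hinv : ∀ N, (μ N).IsMulLeftInvariant)
    (τ : FreeAlgebra ℂ (Fin k) → ℂ)
    (hτ : ∀ q : FreeAlgebra ℂ (Fin k),
      Tendsto (fun N => (∫ U, (evalAt (Λ N) U q).trace ∂(μ N)) / (N : ℂ))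
        atTop (nhds (τ q)))
    (m : ℕ) (i j : Fin (m + 1) → Fin N₀) (q : Fin (m + 1) → FreeAlgebra ℂ (Fin k)) :
    Tendsto (fun N =>
        ∫ U, Matrix.trace
            ((List.ofFn (fun s : Fin (m + 1) =>
              padE N₀ N (i (s - 1)) (j s) * evalAt (Λ N) U (q s))).prod) ∂(μ N))
      atTop
      (nhds (∏ s : Fin (m + 1), (if j s = i s then (1 : ℂ) else 0) * τ (q s))) := by
  obtain ⟨C, hC⟩ := hΛbdd
  choose K hK0 hK using fun s => exists_bound_lift C (q s)
  set M : ℝ := 1 + ∑ s, K s with hM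
  have hM1 : 1 ≤ M := by
    have := Finset.sum_nonneg (fun s (_ : s ∈ Finset.univ) => hK0 s)
    linarith
  have hKM : ∀ s, K s ≤ M := fun s => by
    have := Finset.single_le_sum (f := K) (fun s _ => hK0 s) (Finset.mem_univ s)
    linarith
  let D : (N : ℕ) → Fin (m + 1) → Matrix (Fin N) (Fin N) ℂ :=
    fun N s => FreeAlgebra.lift ℂ (Λ N) (q s)
  have hD : ∀ N s, opNorm (D N s) ≤ M := fun N s => (hK s N (Λ N) (hC N)).trans (hKM s)
  let y : ℕ → Fin (m + 1) → ℂ := fun N s =>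
    (if j s = i s then (1 : ℂ) else 0) * ((D N s).trace / N)
  have hylim : Tendsto (fun N => ∏ s, y N s) atTop
      (nhds (∏ s : Fin (m + 1), (if j s = i s then (1 : ℂ) else 0) * τ (q s))) := by
    refine tendsto_finset_prod _ fun s _ => Tendsto.const_mul _ ?_
    refine (hτ (q s)).congr fun N => ?_
    have := hprob N
    simp only [evalAt_eq, cj_trace]
    simp [D]
  refine tendsto_of_tendsto_of_dist hylim ?_
  have hrate : Tendsto (fun N : ℕ => M ^ (m + 1) * ((m + 1 : ℕ) * (4 * (√N * M / ((N : ℝ) - 1)))))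
      atTop (nhds 0) := by
    simpa using (((tendsto_rate M).const_mul 4).const_mul ((m + 1 : ℕ) : ℝ)).const_mul (M ^ (m + 1))
  refine squeeze_zero' (Eventually.of_forall fun _ => dist_nonneg) ?_ hrate
  filter_upwards [eventually_ge_atTop 2, eventually_ge_atTop N₀] with N hN2 hN
  have := hprob N
  have := hinv N
  have hN' : (2 : ℝ) ≤ N := by exact_mod_cast hN2
  simp only [padE_eq hN, evalAt_eq]
  have htr : ∀ U : Matrix.unitaryGroup (Fin N) ℂ, Matrix.trace
      (List.ofFn (fun s : Fin (m + 1) => Matrix.single (Fin.castLE hN (i (s - 1)))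
        (Fin.castLE hN (j s)) (1 : ℂ) * cj (FreeAlgebra.lift ℂ (Λ N) (q s)) U)).prod
      = ∏ s, cj (D N s) U (Fin.castLE hN (j s)) (Fin.castLE hN (i s)) := fun U =>
    trace_formula m (fun s => Fin.castLE hN (i s)) (fun s => Fin.castLE hN (j s))
      (fun s => cj (D N s) U)
  simp only [htr]
  have hx : ∀ U s, ‖cj (D N s) U (Fin.castLE hN (j s)) (Fin.castLE hN (i s))‖ ≤ M :=
    fun U s => (cj_entry_le _ _ _ _).trans (hD N s)
  have hy : ∀ s, ‖y N s‖ ≤ M := by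
    intro s
    have h1 : ‖(D N s).trace‖ ≤ N * M := by
      refine (norm_sum_le _ _).trans ?_
      refine (Finset.sum_le_sum fun a _ => (opNorm_entry (D N s) a a).trans (hD N s)).trans ?_
      simp
    have h2 : ‖(D N s).trace / N‖ ≤ M := by
      rw [norm_div, Complex.norm_natCast, div_le_iff₀ (by linarith)]
      linarith
    simp only [y]
    split_ifs
    · simpa using h2
    · simp; linarith
  have hxc : ∀ s, Continuous (fun U : Matrix.unitaryGroup (Fin N) ℂ =>
      cj (D N s) U (Fin.castLE hN (j s)) (Fin.castLE hN (i s))) := fun s => cj_entry_cont _ _ _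
  have hint : Integrable (fun U => ∏ s, cj (D N s) U (Fin.castLE hN (j s)) (Fin.castLE hN (i s)))
      (μ N) := by
    refine integrable_of_cont _ _ (continuous_finset_prod _ fun s _ => hxc s) (M ^ (m + 1)) ?_
    intro U
    rw [norm_prod]
    refine (Finset.prod_le_prod (fun s _ => norm_nonneg _) (fun s _ => hx U s)).trans ?_
    simp
  have hdi : ∀ s, Integrable (fun U =>
      ‖cj (D N s) U (Fin.castLE hN (j s)) (Fin.castLE hN (i s)) - y N s‖) (μ N) := fun s =>
    integrable_of_cont _ _ ((hxc s).sub continuous_const).norm (M + M) (fun U => by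
      rw [norm_norm]
      exact (norm_sub_le _ _).trans (add_le_add (hx U s) (hy s)))
  have hs : ∀ s, ∫ U, ‖cj (D N s) U (Fin.castLE hN (j s)) (Fin.castLE hN (i s)) - y N s‖ ∂(μ N)
      ≤ 4 * (√N * M / ((N : ℝ) - 1)) := by
    intro s
    have h := entry_bound (μ N) (D N s) hN2 (Fin.castLE hN (j s)) (Fin.castLE hN (i s))
    simp only [Fin.castLE_inj] at h
    refine h.trans ?_
    have : (0 : ℝ) ≤ N - 1 := by linarith
    have := hD N s
    gcongr
  have hc : ∏ s, y N s = ∫ _U, ∏ s, y N s ∂(μ N) := by simp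
  rw [dist_comm, dist_eq_norm, hc, ← integral_sub hint (integrable_const _)]
  refine (norm_integral_le_integral_norm _).trans ?_
  calc _ ≤ ∫ U, M ^ (m + 1) *
        ∑ s, ‖cj (D N s) U (Fin.castLE hN (j s)) (Fin.castLE hN (i s)) - y N s‖ ∂(μ N) := by
        refine integral_mono_of_nonneg (Eventually.of_forall fun U => norm_nonneg _)
          ((integrable_finset_sum _ fun s _ => hdi s).const_mul _) (Eventually.of_forall fun U => ?_)
        have := norm_prod_sub_le Finset.univ
          (fun s => cj (D N s) U (Fin.castLE hN (j s)) (Fin.castLE hN (i s))) (y N) M hM1 (hx U) hy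
        simpa using this
    _ ≤ _ := by
        rw [integral_const_mul, integral_finset_sum _ fun s _ => hdi s]
        have := Finset.sum_le_sum (fun s (_ : s ∈ Finset.univ) => hs s)
        rw [Finset.sum_const, Finset.card_univ, Fintype.card_fin, nsmul_eq_mul] at this
        gcongr
end

section
/- For every z ∈ ℂ with Im z > 0, ∫_{−√2}^{√2} (1/(z − t)) · (1/π)√(2 − t²) dt = z − w(z), where w(z) is the unique complex number with w(z)² = z² − 2 and Im w(z) > 0. That is, the Cauchy transform of the semicircle law μ_sc satisfies G_{μ_sc}(z) = z − √(z² − 2). -/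
lemma semicircle_exists (z : ℂ) (hz : 0 < z.im) : ∃! w : ℂ, w ^ 2 = z ^ 2 - 2 ∧ 0 < w.im := by
  obtain ⟨s, hs⟩ := IsAlgClosed.exists_pow_nat_eq (z ^ 2 - 2) (n := 2) (by norm_num)
  have him : s.im ≠ 0 := by
    intro h
    have h1 := congrArg Complex.re hs
    have h2 := congrArg Complex.im hs
    simp [pow_two, h] at h1 h2
    have h3 : z.re = 0 := by
      have : z.re * z.im = 0 := by linarith
      rcases mul_eq_zero.1 this with h | h
      · exact h
      · exact absurd h hz.ne'
    rw [h3] at h1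
    nlinarith [mul_self_nonneg s.re, mul_pos hz hz]
  have huniq : ∀ a b : ℂ, a ^ 2 = z ^ 2 - 2 ∧ 0 < a.im → b ^ 2 = z ^ 2 - 2 ∧ 0 < b.im → a = b := by
    rintro a b ⟨ha, ha'⟩ ⟨hb, hb'⟩
    rcases sq_eq_sq_iff_eq_or_eq_neg.1 (ha.trans hb.symm) with h | h
    · exact h
    · rw [h, Complex.neg_im] at ha'
      linarith
  rcases lt_or_gt_of_ne him with h | h
  · have : (-s) ^ 2 = z ^ 2 - 2 ∧ 0 < (-s).im := ⟨by rw [neg_sq, hs], by simpa using h⟩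
    exact ⟨-s, this, fun y hy => huniq _ _ hy this⟩
  · exact ⟨s, ⟨hs, h⟩, fun y hy => huniq _ _ hy ⟨hs, h⟩⟩

lemma semicircle_norm (u z w : ℂ) (h0 : u ≠ 0) (hz : 0 < z.im) (hw : 0 < w.im)
    (h1 : z = (u⁻¹ + u)) (h2 : w = (u⁻¹ - u)) : ‖u‖ < 1 := by
  have hN : 0 < Complex.normSq u := Complex.normSq_pos.2 h0
  rw [h1, Complex.add_im, Complex.inv_im] at hz
  rw [h2, Complex.sub_im, Complex.inv_im] at hw
  have hui : u.im < 0 := by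
    by_contra! h
    have : 0 ≤ u.im / Complex.normSq u := by positivity
    rw [neg_div] at hw
    linarith
  have : Complex.normSq u < 1 := by
    rw [neg_div] at hz
    have h3 : u.im / Complex.normSq u < u.im := by linarith
    rw [div_lt_iff₀ hN] at h3
    nlinarith
  rw [Complex.normSq_eq_norm_sq] at this
  nlinarith [norm_nonneg u]

open Complex in
lemma semicircle_log (u k : ℂ) (hu : ‖u‖ < 1) (hk' : k.re = 0) (x : ℝ) :
    1 - u * exp (k * x) ∈ slitPlane ∧
    HasDerivAt (fun x : ℝ => log (1 - u * exp (k * x)))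
      (-(u * exp (k * x) * k) / (1 - u * exp (k * x))) x := by
  have hn : ‖u * exp (k * x)‖ < 1 := by
    rw [norm_mul, Complex.norm_exp]
    simpa [hk'] using hu
  have hs : 1 - u * exp (k * x) ∈ slitPlane := by
    left
    have := (Complex.re_le_norm (u * exp (k * x))).trans_lt hn
    rw [sub_re, one_re]
    linarith
  refine ⟨hs, ?_⟩
  have hd : HasDerivAt (fun y : ℂ => 1 - u * exp (k * y)) (-(u * (exp (k * x) * (k * 1)))) (x : ℂ) :=
    ((((hasDerivAt_id (x : ℂ)).const_mul k).cexp).const_mul u).const_sub 1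
  have := (hd.clog hs).comp_ofReal
  convert this using 1
  ring

open Complex in
lemma semicircle_trig (u : ℂ) (h0 : u ≠ 0) (hu : ‖u‖ < 1) :
    (∀ x : ℝ, 1 + u ^ 2 - 2 * u * cos x ≠ 0) ∧
    (∫ x in (0 : ℝ)..Real.pi, 2 * sin (x : ℂ) ^ 2 / (1 + u ^ 2 - 2 * u * cos x)) = (Real.pi : ℂ) := by
  have hI := I_sq
  have key : ∀ x : ℝ, (1 - u * exp (I * x)) * (1 - u * exp (-I * x)) = 1 + u ^ 2 - 2 * u * cos x := by
    intro x
    have : exp (I * x) * exp (-I * x) = 1 := by rw [← exp_add]; simp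
    rw [cos, show (x : ℂ) * I = I * x by ring, show -(x : ℂ) * I = -I * x by ring]
    linear_combination u ^ 2 * this
  have hA : ∀ x : ℝ, 1 - u * exp (I * x) ≠ 0 := fun x =>
    slitPlane_ne_zero (semicircle_log u I hu (by simp) x).1
  have hB : ∀ x : ℝ, 1 - u * exp (-I * x) ≠ 0 := fun x =>
    slitPlane_ne_zero (semicircle_log u (-I) hu (by simp) x).1
  have hD : ∀ x : ℝ, 1 + u ^ 2 - 2 * u * cos x ≠ 0 := fun x => by
    rw [← key]; exact mul_ne_zero (hA x) (hB x)
  refine ⟨hD, ?_⟩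
  have hcont : Continuous fun x : ℝ => 2 * sin (x : ℂ) ^ 2 / (1 + u ^ 2 - 2 * u * cos x) :=
    Continuous.div (by fun_prop) (by fun_prop) hD
  rw [intervalIntegral.integral_eq_sub_of_hasDerivAt
    (f := fun x : ℝ => -(1 - u ^ 2) / (2 * u ^ 2) * (x + I * (log (1 - u * exp (I * x))
      - log (1 - u * exp (-I * x)))) + (1 + u ^ 2) / (2 * u ^ 2) * x + 1 / u * sin x)
    ?_ (hcont.intervalIntegrable _ _)]
  · have e1 : exp (I * Real.pi) = -1 := by rw [mul_comm]; exact exp_pi_mul_I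
    have e2 : exp (-I * Real.pi) = -1 := by rw [neg_mul, exp_neg, e1]; norm_num
    simp only [e1, e2]
    simp
    field_simp
    ring
  · intro x _
    have d1 := (semicircle_log u I hu (by simp) x).2
    have d2 := (semicircle_log u (-I) hu (by simp) x).2
    have d0 : HasDerivAt (fun x : ℝ => (x : ℂ)) 1 x := (hasDerivAt_id (x : ℂ)).comp_ofReal
    have d3 : HasDerivAt (fun x : ℝ => sin (x : ℂ)) (cos x) x := (hasDerivAt_sin (x : ℂ)).comp_ofReal
    have := (((d0.add ((d1.sub d2).const_mul I)).const_mul (-(1 - u ^ 2) / (2 * u ^ 2))).add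
      (d0.const_mul ((1 + u ^ 2) / (2 * u ^ 2)))).add (d3.const_mul (1 / u))
    refine this.congr_deriv ?_
    have hS : sin (x : ℂ) ^ 2 = 1 - cos (x : ℂ) ^ 2 := by
      linear_combination sin_sq_add_cos_sq (x : ℂ)
    have hp : exp (I * x) * exp (-I * x) = 1 := by rw [← exp_add]; simp
    have hc : exp (I * x) + exp (-I * x) = 2 * cos x := by
      rw [cos, show (x : ℂ) * I = I * x by ring, show -(x : ℂ) * I = -I * x by ring]; ring
    have hmid : 1 + I * (-(u * exp (I * x) * I) / (1 - u * exp (I * x)) -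
        -(u * exp (-I * x) * -I) / (1 - u * exp (-I * x))) =
        (1 - u ^ 2) / (1 + u ^ 2 - 2 * u * cos x) := by
      rw [← key]
      have a := hA x
      have b := hB x
      generalize exp (I * x) = p at *
      generalize exp (-I * x) = q at *
      field_simp
      linear_combination (-(u * p * (1 - u * q)) - u * q * (1 - u * p)) * hI - u ^ 2 * hp
    rw [hmid, hS]
    have d := hD x
    clear hmid hS hc d3 this hcont
    generalize Complex.cos (x : ℂ) = c at d ⊢
    obtain ⟨A, hA'⟩ : ∃ A, A = 1 + u ^ 2 - 2 * u * c := ⟨_, rfl⟩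
    rw [← hA'] at d ⊢
    field_simp
    rw [hA']
    ring

lemma semicircle_integral (z w : ℂ) (hz : 0 < z.im) (hw2 : w ^ 2 = z ^ 2 - 2) (hw : 0 < w.im) :
      (∫ t in (-Real.sqrt 2)..(Real.sqrt 2),
          (z - (t : ℂ))⁻¹ * ((Real.sqrt (2 - t ^ 2) / Real.pi : ℝ) : ℂ)) = z - w := by
  have hr : (0 : ℝ) < Real.sqrt 2 := by positivity
  have hrr : Real.sqrt 2 ^ 2 = 2 := Real.sq_sqrt (by norm_num)
  have hrC : ((Real.sqrt 2 : ℝ) : ℂ) ^ 2 = 2 := by exact_mod_cast hrr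
  have hrC0 : ((Real.sqrt 2 : ℝ) : ℂ) ≠ 0 := by exact_mod_cast hr.ne'
  set r : ℝ := Real.sqrt 2 with hrdef
  obtain ⟨u, hu⟩ : ∃ u : ℂ, u = (z - w) / r := ⟨_, rfl⟩
  have hmul : u * ((z + w) / r) = 1 := by
    rw [hu]; field_simp; linear_combination -hw2 - hrC
  have h0 : u ≠ 0 := left_ne_zero_of_mul_eq_one hmul
  have hinv : u⁻¹ = (z + w) / r := inv_eq_of_mul_eq_one_right hmul
  have hzr : (r : ℂ) * z = u⁻¹ + u := by
    rw [hinv, hu]; field_simp; linear_combination z * hrC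
  have hwr : (r : ℂ) * w = u⁻¹ - u := by
    rw [hinv, hu]; field_simp; linear_combination w * hrC
  have hn : ‖u‖ < 1 := semicircle_norm u (r * z) (r * w) h0
    (by rw [Complex.im_ofReal_mul r z]; positivity)
    (by rw [Complex.im_ofReal_mul r w]; positivity) hzr hwr
  obtain ⟨hD, hI⟩ := semicircle_trig u h0 hn
  have hne : ∀ t : ℝ, z - (t : ℂ) ≠ 0 := by
    intro t h
    have := congrArg Complex.im h
    simp at this
    exact hz.ne' this
  have hg : Continuous fun t : ℝ => (z - (t : ℂ))⁻¹ * ((Real.sqrt (2 - t ^ 2) / Real.pi : ℝ) : ℂ) := by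
    refine Continuous.mul (Continuous.inv₀ (by fun_prop) hne) ?_
    fun_prop
  have hsub := intervalIntegral.integral_deriv_smul_comp (a := 0) (b := Real.pi)
    (f := fun x => r * Real.cos x) (f' := fun x => r * (-Real.sin x))
    (g := fun t : ℝ => (z - (t : ℂ))⁻¹ * ((Real.sqrt (2 - t ^ 2) / Real.pi : ℝ) : ℂ))
    (fun x _ => (Real.hasDerivAt_cos x).const_mul r) (by fun_prop) hg
  simp only [Real.cos_zero, Real.cos_pi, mul_one, mul_neg] at hsub
  rw [intervalIntegral.integral_symm, ← hsub, ← intervalIntegral.integral_neg]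
  have hpi : (Real.pi : ℂ) ≠ 0 := by exact_mod_cast Real.pi_ne_zero
  have hzw : z - w = (r * u / Real.pi) * Real.pi := by
    rw [hu]; field_simp
  have hI' := congrArg (fun y => (r * u / Real.pi) * y) hI
  beta_reduce at hI'
  rw [hzw, ← hI', ← intervalIntegral.integral_const_mul]
  refine intervalIntegral.integral_congr fun x hx => ?_
  rw [Set.uIcc_of_le Real.pi_pos.le] at hx
  have hs : Real.sqrt (2 - (r * Real.cos x) ^ 2) = r * Real.sin x := by
    rw [show 2 - (r * Real.cos x) ^ 2 = (r * Real.sin x) ^ 2 by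
      rw [mul_pow, mul_pow, hrr]; linarith [Real.sin_sq_add_cos_sq x]]
    exact Real.sqrt_sq (mul_nonneg hr.le (Real.sin_nonneg_of_mem_Icc hx))
  have h1 := hne (r * Real.cos x)
  have h2 := hD x
  have hrel : (r : ℂ) * u * (z - r * Complex.cos x) = 1 + u ^ 2 - 2 * u * Complex.cos x := by
    have : u * u⁻¹ = 1 := mul_inv_cancel₀ h0
    linear_combination u * hzr + this - u * Complex.cos x * hrC
  simp only [Function.comp, hs, Complex.real_smul]
  push_cast at h1 ⊢
  rw [← hrel] at h2 ⊢
  field_simp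
  linear_combination Complex.sin x ^ 2 * hrC


/-- The Cauchy transform of the semicircle law on `[-√2, √2]` (with density
`(1/π)·√(2 - t²)`) is `z - √(z² - 2)`, where the square root `w` of `z² - 2` is
the unique one with positive imaginary part. -/
theorem cauchy_transform_semicircle (z : ℂ) (hz : 0 < z.im) :
    (∃! w : ℂ, w ^ 2 = z ^ 2 - 2 ∧ 0 < w.im) ∧
    ∀ w : ℂ, w ^ 2 = z ^ 2 - 2 → 0 < w.im →
      (∫ t in (-Real.sqrt 2)..(Real.sqrt 2),
          (z - (t : ℂ))⁻¹ * ((Real.sqrt (2 - t ^ 2) / Real.pi : ℝ) : ℂ)) = z - w := by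
  exact ⟨semicircle_exists z hz, fun w h1 h2 => semicircle_integral z w hz h1 h2⟩
end
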